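/- Let α > 0 and κ² > 0, and suppose 0 < δ̃ < 1 and θ > 0 satisfy θ^{−1/(2α)} = log(1 + 1/δ̃) + 2κ²/δ̃. Then δ̃ ≤ 2 exp(−(1/3) θ^{−1/(2α)}) + 3κ² θ^{1/(2α)}. -/

import Mathlib

/-!
STATEMENT 16: Let `α > 0` and `κ² > 0`, and suppose `0 < δ̃ < 1` and `θ > 0` satisfy
`θ^{-1/(2α)} = log(1 + 1/δ̃) + 2κ²/δ̃`.  Then
`δ̃ ≤ 2 exp(-(1/3) θ^{-1/(2α)}) + 3κ² θ^{1/(2α)}`.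
-/
theorem statement16 (α κ θ δ : ℝ) (hα : 0 < α) (hκ : 0 < κ ^ 2)
    (hθ : 0 < θ) (hδ : 0 < δ) (hδ1 : δ < 1)
    (heq : θ ^ (-(1 / (2 * α))) = Real.log (1 + 1 / δ) + 2 * κ ^ 2 / δ) :
    δ ≤ 2 * Real.exp (-(1 / 3) * θ ^ (-(1 / (2 * α)))) + 3 * κ ^ 2 * θ ^ (1 / (2 * α)) := by
  have hL : 0 < Real.log (1 + 1 / δ) := Real.log_pos (by linarith [one_div_pos.mpr hδ])
  have hT : θ ^ (1 / (2 * α)) = (θ ^ (-(1 / (2 * α))))⁻¹ := by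
    rw [Real.rpow_neg hθ.le, inv_inv]
  rw [hT, heq]
  set L := Real.log (1 + 1 / δ) with hLdef
  have hx : 0 < 2 * κ ^ 2 / δ := by positivity
  have hκx : κ ^ 2 = δ * (2 * κ ^ 2 / δ) / 2 := by field_simp
  set x := 2 * κ ^ 2 / δ
  rw [hκx]
  rcases le_total (2 * L) x with h | h
  · have hfrac : δ ≤ 3 * (δ * x / 2) * (L + x)⁻¹ := by
      rw [← div_eq_mul_inv, le_div_iff₀ (by positivity)]
      nlinarith
    linarith [Real.exp_pos (-(1 / 3) * (L + x))]
  · have hexpL : Real.exp (-L) = δ / (1 + δ) := by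
      rw [Real.exp_neg, hLdef, Real.exp_log (by positivity)]
      field_simp
      ring
    have hmono : Real.exp (-L) ≤ Real.exp (-(1 / 3) * (L + x)) :=
      Real.exp_le_exp.mpr (by linarith)
    have hhalf : δ / 2 ≤ δ / (1 + δ) := by
      gcongr
      linarith
    have hrest : 0 ≤ 3 * (δ * x / 2) * (L + x)⁻¹ := by positivity
    linarith
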